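/- Let n ≥ 1, let A ∈ ℂ^{n×n} be Hermitian with largest eigenvalue λ_max(A), and let e ∈ ℂⁿ be nonzero. Then the function N(μ) := ‖(A − μI)^{-1}e‖² / (eᴴ(A − μI)^{-1}e)², which equals the squared Euclidean norm of c(μ) := ((A − μI)^{-1}e)/(eᴴ(A − μI)^{-1}e), is well defined and non-increasing (antitone) on the open interval (λ_max(A), +∞): for all λ_max(A) < μ ≤ μ', N(μ') ≤ N(μ). -/

import Mathlib

open Matrix

/-- If `a = b + t a b` with `a, b, t ≥ 0`, as for the resolvent values `a = 1 / d` and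
`b = 1 / (d + t)`, then the ratio of the second weighted moment to the square of the first
is no larger for `b` than for `a` (in cross-multiplied form). -/
lemma sum_mul_sq_mul_sq_sum_le {ι : Type*} (s : Finset ι) {w a b : ι → ℝ} {t : ℝ} (ht : 0 ≤ t)
    (hw : ∀ i ∈ s, 0 ≤ w i) (ha : ∀ i ∈ s, 0 ≤ a i) (hb : ∀ i ∈ s, 0 ≤ b i)
    (hab : ∀ i ∈ s, a i = b i + t * (a i * b i)) :
    (∑ i ∈ s, w i * b i ^ 2) * (∑ i ∈ s, w i * a i) ^ 2 ≤
      (∑ i ∈ s, w i * a i ^ 2) * (∑ i ∈ s, w i * b i) ^ 2 := by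
  have e₁ : ∑ i ∈ s, w i * a i = ∑ i ∈ s, w i * b i + t * ∑ i ∈ s, w i * (a i * b i) := by
    rw [Finset.mul_sum, ← Finset.sum_add_distrib]
    refine Finset.sum_congr rfl fun i hi => ?_
    linear_combination w i * hab i hi
  have e₂ : ∑ i ∈ s, w i * (a i * b i) =
      ∑ i ∈ s, w i * b i ^ 2 + t * ∑ i ∈ s, w i * a i * b i ^ 2 := by
    rw [Finset.mul_sum, ← Finset.sum_add_distrib]
    refine Finset.sum_congr rfl fun i hi => ?_
    linear_combination w i * b i * hab i hi
  have e₃ : ∑ i ∈ s, w i * a i ^ 2 =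
      ∑ i ∈ s, w i * (a i * b i) + t * ∑ i ∈ s, w i * a i ^ 2 * b i := by
    rw [Finset.mul_sum, ← Finset.sum_add_distrib]
    refine Finset.sum_congr rfl fun i hi => ?_
    linear_combination w i * a i * hab i hi
  have cs₁ : (∑ i ∈ s, w i * (a i * b i)) ^ 2 ≤
      (∑ i ∈ s, w i * a i) * ∑ i ∈ s, w i * a i * b i ^ 2 :=
    Finset.sum_sq_le_sum_mul_sum_of_sq_le_mul s (fun i hi => mul_nonneg (hw i hi) (ha i hi))
      (fun i hi => mul_nonneg (mul_nonneg (hw i hi) (ha i hi)) (sq_nonneg _)) fun i _ => le_of_eq (by ring)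
  have cs₂ : (∑ i ∈ s, w i * (a i * b i)) ^ 2 ≤
      (∑ i ∈ s, w i * a i ^ 2 * b i) * ∑ i ∈ s, w i * b i :=
    Finset.sum_sq_le_sum_mul_sum_of_sq_le_mul s
      (fun i hi => mul_nonneg (mul_nonneg (hw i hi) (sq_nonneg _)) (hb i hi))
      (fun i hi => mul_nonneg (hw i hi) (hb i hi)) fun i _ => le_of_eq (by ring)
  have ha₀ : 0 ≤ ∑ i ∈ s, w i * a i := Finset.sum_nonneg fun i hi => mul_nonneg (hw i hi) (ha i hi)
  have hb₀ : 0 ≤ ∑ i ∈ s, w i * b i := Finset.sum_nonneg fun i hi => mul_nonneg (hw i hi) (hb i hi)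
  generalize ∑ i ∈ s, w i * a i = A₁ at *
  generalize ∑ i ∈ s, w i * b i = B₁ at *
  generalize ∑ i ∈ s, w i * a i ^ 2 = A₂ at *
  generalize ∑ i ∈ s, w i * b i ^ 2 = B₂ at *
  generalize ∑ i ∈ s, w i * (a i * b i) = C at *
  generalize ∑ i ∈ s, w i * a i * b i ^ 2 = D at *
  generalize ∑ i ∈ s, w i * a i ^ 2 * b i = E at *
  have h₁ : B₂ * A₁ ≤ B₁ * C := by
    linear_combination t * cs₁ - A₁ * e₂ + C * e₁
  have h₂ : C * A₁ ≤ B₁ * A₂ := by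
    linear_combination t * cs₂ + C * e₁ - B₁ * e₃
  calc B₂ * A₁ ^ 2 = B₂ * A₁ * A₁ := by ring
    _ ≤ B₁ * C * A₁ := mul_le_mul_of_nonneg_right h₁ ha₀
    _ = B₁ * (C * A₁) := by ring
    _ ≤ B₁ * (B₁ * A₂) := mul_le_mul_of_nonneg_left h₂ hb₀
    _ = A₂ * B₁ ^ 2 := by ring

namespace Matrix.IsHermitian

variable {n : Type*} [Fintype n] [DecidableEq n] {A : Matrix n n ℂ} (hA : A.IsHermitian)

/-- The coordinates of a vector in the eigenvector basis of a Hermitian matrix. -/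
noncomputable def eigenCoords (e : n → ℂ) : n → ℂ :=
  (hA.eigenvectorUnitary : Matrix n n ℂ)ᴴ *ᵥ e

lemma eigenvectorUnitary_mulVec_eigenCoords (e : n → ℂ) :
    (hA.eigenvectorUnitary : Matrix n n ℂ) *ᵥ hA.eigenCoords e = e := by
  rw [eigenCoords, mulVec_mulVec, ← star_eq_conjTranspose,
    Unitary.mul_star_self_of_mem hA.eigenvectorUnitary.2, one_mulVec]

lemma inv_sub_smul_one_mulVec {μ : ℝ} (hμ : ∀ i, hA.eigenvalues i ≠ μ) (e : n → ℂ) :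
    (A - (μ : ℂ) • 1)⁻¹ *ᵥ e = (hA.eigenvectorUnitary : Matrix n n ℂ) *ᵥ
      fun i => (((hA.eigenvalues i - μ)⁻¹ : ℝ) : ℂ) * hA.eigenCoords e i := by
  set U := (hA.eigenvectorUnitary : Matrix n n ℂ)
  have hUU : U * star U = 1 := Unitary.mul_star_self_of_mem hA.eigenvectorUnitary.2
  have hUU' : star U * U = 1 := Unitary.star_mul_self_of_mem hA.eigenvectorUnitary.2
  have hsub : A - (μ : ℂ) • 1 =
      U * diagonal (fun i => ((hA.eigenvalues i - μ : ℝ) : ℂ)) * star U := by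
    have hd : diagonal (fun i => ((hA.eigenvalues i - μ : ℝ) : ℂ)) =
        diagonal (RCLike.ofReal ∘ hA.eigenvalues) - (μ : ℂ) • (1 : Matrix n n ℂ) := by
      ext i j
      by_cases h : i = j <;> simp [h]
    have hs : A = U * diagonal (RCLike.ofReal ∘ hA.eigenvalues) * star U := by
      simpa only [Unitary.conjStarAlgAut_apply, Unitary.coe_star] using hA.spectral_theorem
    rw [hd, mul_sub, sub_mul, ← hs, mul_smul_comm, mul_one, smul_mul_assoc, hUU]
  have hinv : (A - (μ : ℂ) • 1)⁻¹ =
      U * diagonal (fun i => (((hA.eigenvalues i - μ)⁻¹ : ℝ) : ℂ)) * star U := by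
    refine inv_eq_right_inv ?_
    have hd : diagonal (fun i => ((hA.eigenvalues i - μ : ℝ) : ℂ)) *
        diagonal (fun i => (((hA.eigenvalues i - μ)⁻¹ : ℝ) : ℂ)) = 1 := by
      rw [diagonal_mul_diagonal, ← diagonal_one]
      congr 1
      ext i
      rw [← Complex.ofReal_mul, mul_inv_cancel₀ (sub_ne_zero.2 (hμ i)), Complex.ofReal_one]
    rw [hsub, mul_assoc, mul_assoc, mul_assoc, ← mul_assoc (star U), hUU', one_mul,
      ← mul_assoc (diagonal _), hd, one_mul, hUU]
  rw [hinv, ← mulVec_mulVec, ← mulVec_mulVec]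
  congr 1
  ext i
  rw [mulVec_diagonal]
  rfl

lemma star_dotProduct_inv_sub_smul_one_mulVec {μ : ℝ} (hμ : ∀ i, hA.eigenvalues i ≠ μ)
    (e : n → ℂ) : star e ⬝ᵥ ((A - (μ : ℂ) • 1)⁻¹ *ᵥ e) =
      ((∑ i, Complex.normSq (hA.eigenCoords e i) * (hA.eigenvalues i - μ)⁻¹ : ℝ) : ℂ) := by
  have hstar : star e ᵥ* (hA.eigenvectorUnitary : Matrix n n ℂ) = star (hA.eigenCoords e) := by
    rw [eigenCoords, star_mulVec, conjTranspose_conjTranspose]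
  rw [hA.inv_sub_smul_one_mulVec hμ, dotProduct_mulVec, hstar, dotProduct, Complex.ofReal_sum]
  refine Finset.sum_congr rfl fun i _ => ?_
  rw [Complex.ofReal_mul, Complex.normSq_eq_conj_mul_self, Pi.star_apply, starRingEnd_apply]
  ring

lemma star_inv_sub_smul_one_mulVec_dotProduct_self {μ : ℝ} (hμ : ∀ i, hA.eigenvalues i ≠ μ)
    (e : n → ℂ) :
    star ((A - (μ : ℂ) • 1)⁻¹ *ᵥ e) ⬝ᵥ ((A - (μ : ℂ) • 1)⁻¹ *ᵥ e) =
      ((∑ i, Complex.normSq (hA.eigenCoords e i) * (hA.eigenvalues i - μ)⁻¹ ^ 2 : ℝ) : ℂ) := by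
  rw [hA.inv_sub_smul_one_mulVec hμ, star_mulVec, dotProduct_mulVec, vecMul_vecMul,
    ← star_eq_conjTranspose, Unitary.coe_star_mul_self, vecMul_one, dotProduct,
    Complex.ofReal_sum]
  refine Finset.sum_congr rfl fun i _ => ?_
  rw [Complex.ofReal_mul, Complex.normSq_eq_conj_mul_self, Pi.star_apply, star_mul',
    Complex.star_def, Complex.conj_ofReal, Complex.ofReal_pow]
  ring

end Matrix.IsHermitian

/-- Monotonicity (Proposition 2): for Hermitian `A` with largest eigenvalue `lam`
and `e ≠ 0`, the function `N(μ) = ‖(A − μI)⁻¹ e‖² / (eᴴ(A − μI)⁻¹e)²` is well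
defined (the denominator quadratic form is a strictly negative real) and
non-increasing on `(lam, +∞)`. -/
theorem stmt_11 (n : ℕ) (hn : 1 ≤ n) (A : Matrix (Fin n) (Fin n) ℂ)
    (hA : A.IsHermitian) (lam : ℝ)
    (hmem : ∃ i, hA.eigenvalues i = lam)
    (hub : ∀ i, hA.eigenvalues i ≤ lam)
    (e : Fin n → ℂ) (he : e ≠ 0) :
    (∀ μ : ℝ, lam < μ →
      (star e ⬝ᵥ ((A - (μ : ℂ) • 1)⁻¹ *ᵥ e)).im = 0 ∧
      (star e ⬝ᵥ ((A - (μ : ℂ) • 1)⁻¹ *ᵥ e)).re < 0) ∧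
    (∀ μ μ' : ℝ, lam < μ → μ ≤ μ' →
      (star ((A - (μ' : ℂ) • 1)⁻¹ *ᵥ e) ⬝ᵥ ((A - (μ' : ℂ) • 1)⁻¹ *ᵥ e)).re /
          ((star e ⬝ᵥ ((A - (μ' : ℂ) • 1)⁻¹ *ᵥ e)).re) ^ 2 ≤
        (star ((A - (μ : ℂ) • 1)⁻¹ *ᵥ e) ⬝ᵥ ((A - (μ : ℂ) • 1)⁻¹ *ᵥ e)).re /
          ((star e ⬝ᵥ ((A - (μ : ℂ) • 1)⁻¹ *ᵥ e)).re) ^ 2) := by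
  have hne : ∀ {μ : ℝ}, lam < μ → ∀ i, hA.eigenvalues i ≠ μ :=
    fun h i => ((hub i).trans_lt h).ne
  have hneg : ∀ μ : ℝ, lam < μ →
      ∑ i, Complex.normSq (hA.eigenCoords e i) * (hA.eigenvalues i - μ)⁻¹ < 0 := by
    intro μ h
    have hlt : ∀ i, (hA.eigenvalues i - μ)⁻¹ < 0 :=
      fun i => inv_lt_zero.2 (sub_neg.2 ((hub i).trans_lt h))
    have hv : hA.eigenCoords e ≠ 0 := by
      intro h0
      apply he
      rw [← hA.eigenvectorUnitary_mulVec_eigenCoords e, h0, mulVec_zero]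
    obtain ⟨j, hj⟩ := Function.ne_iff.1 hv
    exact Finset.sum_neg' (fun i _ => mul_nonpos_of_nonneg_of_nonpos (Complex.normSq_nonneg _)
      (hlt i).le) ⟨j, Finset.mem_univ j, mul_neg_of_pos_of_neg (Complex.normSq_pos.2 hj) (hlt j)⟩
  refine ⟨fun μ h => ?_, fun μ μ' h hle => ?_⟩
  · rw [hA.star_dotProduct_inv_sub_smul_one_mulVec (hne h)]
    exact ⟨Complex.ofReal_im _, hneg μ h⟩
  · have h' : lam < μ' := h.trans_le hle
    rw [hA.star_dotProduct_inv_sub_smul_one_mulVec (hne h),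
      hA.star_dotProduct_inv_sub_smul_one_mulVec (hne h'),
      hA.star_inv_sub_smul_one_mulVec_dotProduct_self (hne h),
      hA.star_inv_sub_smul_one_mulVec_dotProduct_self (hne h')]
    simp only [Complex.ofReal_re]
    rw [div_le_div_iff₀ (sq_pos_of_neg (hneg μ' h')) (sq_pos_of_neg (hneg μ h))]
    have hpos : ∀ {ν : ℝ}, lam < ν → ∀ i, 0 < ν - hA.eigenvalues i :=
      fun hν i => sub_pos.2 ((hub i).trans_lt hν)
    have key := sum_mul_sq_mul_sq_sum_le Finset.univ
      (w := fun i => Complex.normSq (hA.eigenCoords e i))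
      (a := fun i => (μ - hA.eigenvalues i)⁻¹) (b := fun i => (μ' - hA.eigenvalues i)⁻¹)
      (sub_nonneg.2 hle) (fun i _ => Complex.normSq_nonneg _)
      (fun i _ => (inv_pos.2 (hpos h i)).le) (fun i _ => (inv_pos.2 (hpos h' i)).le)
      (fun i _ => by
        have h₁ := (hpos h i).ne'
        have h₂ := (hpos h' i).ne'
        field_simp
        ring)
    have hflip : ∀ (ν : ℝ) i, (hA.eigenvalues i - ν)⁻¹ = -(ν - hA.eigenvalues i)⁻¹ :=
      fun ν i => by rw [← inv_neg, neg_sub]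
    simpa only [hflip, neg_sq, mul_neg, Finset.sum_neg_distrib] using key
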